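/- Let g be a Lie algebra over K (char 0), t ∈ K with t ≠ 0, t ≠ 1, and suppose g₂ := ⁅⁅g,g⁆, g⁆ is nonzero. Then any (t,1,0)-derivation D of g vanishes on g₂; in particular D descends to a map ⁅g,g⁆/g₂ → Z(g) ∩ ⁅g,g⁆, so dim D(t,1,0)(g) ≤ dim Ω(g) + dim Hom(⁅g,g⁆/g₂, Z(g) ∩ ⁅g,g⁆). -/

import Mathlib

section Defs
variable (K L : Type*) [Field K] [LieRing L] [LieAlgebra K L]

/-- The space of (t,1,0)-derivations of a Lie algebra. -/
def lieDerivSpace (t : K) : Submodule K (L →ₗ[K] L) where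
  carrier := {D | ∀ X Y : L, t • D ⁅X, Y⁆ = ⁅D X, Y⁆}
  add_mem' := by
    intro a b ha hb X Y
    simp only [LinearMap.add_apply, smul_add, ha X Y, hb X Y, add_lie]
  zero_mem' := by intro X Y; simp
  smul_mem' := by
    intro c a ha X Y
    simp only [LinearMap.smul_apply, smul_comm t c, ha X Y, smul_lie]

/-- The center of a Lie algebra, as a submodule. -/
def lieCenterSub : Submodule K L where
  carrier := {X | ∀ Y : L, ⁅X, Y⁆ = 0}
  add_mem' := by intro a b ha hb Y; simp [add_lie, ha Y, hb Y]
  zero_mem' := by intro Y; simp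
  smul_mem' := by intro c a ha Y; simp [smul_lie, ha Y]

/-- The derived subalgebra, as a submodule. -/
def lieDerivedSub : Submodule K L :=
  Submodule.span K {z | ∃ X Y : L, ⁅X, Y⁆ = z}

/-- The space Ω(g) of linear maps with image in the center and killing the derived subalgebra. -/
def lieOmega : Submodule K (L →ₗ[K] L) where
  carrier := {T | (∀ x y : L, ⁅T x, y⁆ = 0) ∧ ∀ x ∈ lieDerivedSub K L, T x = 0}
  add_mem' := by
    intro a b ha hb
    refine ⟨fun x y => ?_, fun x hx => ?_⟩
    · simp [add_lie, ha.1 x y, hb.1 x y]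
    · simp [ha.2 x hx, hb.2 x hx]
  zero_mem' := ⟨by simp, by simp⟩
  smul_mem' := by
    intro c a ha
    refine ⟨fun x y => ?_, fun x hx => ?_⟩
    · simp [smul_lie, ha.1 x y]
    · simp [ha.2 x hx]

end Defs

section Helpers
variable {K L : Type*} [Field K] [LieRing L] [LieAlgebra K L] {t : K} {D : L →ₗ[K] L}

theorem lie_apply_right_of_mem_lieDerivSpace (hD : D ∈ lieDerivSpace K L t) (X Y : L) :
    ⁅X, D Y⁆ = t • D ⁅X, Y⁆ := by
  rw [← lie_skew, ← hD Y X, ← lie_skew X Y, map_neg, smul_neg]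

theorem apply_lie_lie_of_mem_lieDerivSpace (ht0 : t ≠ 0) (ht1 : t ≠ 1)
    (hD : D ∈ lieDerivSpace K L t) (X Y Z : L) : D ⁅⁅X, Y⁆, Z⁆ = 0 := by
  have hr := lie_apply_right_of_mem_lieDerivSpace hD
  have h : t • D ⁅⁅X, Y⁆, Z⁆ = t • t • D ⁅⁅X, Y⁆, Z⁆ := by
    calc t • D ⁅⁅X, Y⁆, Z⁆ = ⁅X, ⁅Y, D Z⁆⁆ - ⁅Y, ⁅X, D Z⁆⁆ := by rw [← hr, lie_lie]
      _ = t • t • D ⁅⁅X, Y⁆, Z⁆ := by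
        rw [hr Y Z, hr X Z, lie_smul, lie_smul, hr, hr, lie_lie, map_sub, smul_sub, smul_sub]
  have h1 : (1 - t) • D ⁅⁅X, Y⁆, Z⁆ = 0 := by
    rw [sub_smul, one_smul, sub_eq_zero]
    exact smul_right_injective L ht0 h
  exact (smul_eq_zero.mp h1).resolve_left (sub_ne_zero.mpr ht1.symm)

theorem apply_eq_zero_of_mem_lieDerivSpace (ht0 : t ≠ 0) (ht1 : t ≠ 1)
    (hD : D ∈ lieDerivSpace K L t) {x : L}
    (hx : x ∈ Submodule.span K {z : L | ∃ X Y Z : L, ⁅⁅X, Y⁆, Z⁆ = z}) : D x = 0 := by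
  have h : Submodule.span K {z : L | ∃ X Y Z : L, ⁅⁅X, Y⁆, Z⁆ = z} ≤ LinearMap.ker D := by
    rw [Submodule.span_le]
    rintro _ ⟨X, Y, Z, rfl⟩
    exact apply_lie_lie_of_mem_lieDerivSpace ht0 ht1 hD X Y Z
  exact h hx

theorem apply_mem_center_inf_derived (ht0 : t ≠ 0) (ht1 : t ≠ 1)
    (hD : D ∈ lieDerivSpace K L t) {x : L} (hx : x ∈ lieDerivedSub K L) :
    D x ∈ lieCenterSub K L ⊓ lieDerivedSub K L := by
  have h : lieDerivedSub K L ≤ (lieCenterSub K L ⊓ lieDerivedSub K L).comap D := by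
    refine Submodule.span_le.mpr ?_
    rintro _ ⟨X, Y, rfl⟩
    refine ⟨fun Z => ?_, ?_⟩
    · rw [← hD, apply_lie_lie_of_mem_lieDerivSpace ht0 ht1 hD, smul_zero]
    · have hDXY : D ⁅X, Y⁆ = t⁻¹ • ⁅D X, Y⁆ := by rw [← hD, inv_smul_smul₀ ht0]
      change D ⁅X, Y⁆ ∈ lieDerivedSub K L
      rw [hDXY]
      exact Submodule.smul_mem _ _ (Submodule.subset_span ⟨D X, Y, rfl⟩)
  exact h hx

theorem mem_lieOmega_of_mem_lieDerivSpace (hD : D ∈ lieDerivSpace K L t)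
    (h : ∀ x ∈ lieDerivedSub K L, D x = 0) : D ∈ lieOmega K L :=
  ⟨fun x y => by rw [← hD, h _ (Submodule.subset_span ⟨x, y, rfl⟩), smul_zero], h⟩

/-- Maps out of a quotient of `P` into a submodule `C` of `M`, viewed as maps `P → M`. -/
def homQuotientToHom {M P : Type*} [AddCommGroup M] [Module K M] [AddCommGroup P] [Module K P]
    (N : Submodule K P) (C : Submodule K M) : ((P ⧸ N) →ₗ[K] C) →ₗ[K] (P →ₗ[K] M) where
  toFun f := C.subtype ∘ₗ f ∘ₗ N.mkQ
  map_add' _ _ := rfl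
  map_smul' _ _ := rfl

end Helpers

theorem stmt_18 {K L : Type*} [Field K] [CharZero K] [LieRing L] [LieAlgebra K L]
    [FiniteDimensional K L]
    (t : K) (ht0 : t ≠ 0) (ht1 : t ≠ 1)
    (g₂ : Submodule K L) (hg₂ : g₂ = Submodule.span K {z : L | ∃ X Y Z : L, ⁅⁅X, Y⁆, Z⁆ = z})
    (hg₂ne : g₂ ≠ ⊥) :
    (∀ D ∈ lieDerivSpace K L t, ∀ x ∈ g₂, D x = 0) ∧
      Module.finrank K (lieDerivSpace K L t) ≤
        Module.finrank K (lieOmega K L) +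
          Module.finrank K
            ((↥(lieDerivedSub K L) ⧸ g₂.comap (lieDerivedSub K L).subtype) →ₗ[K]
              ↥(lieCenterSub K L ⊓ lieDerivedSub K L)) := by
  have hzero : ∀ D ∈ lieDerivSpace K L t, ∀ x ∈ g₂, D x = 0 := fun D hD x hx =>
    apply_eq_zero_of_mem_lieDerivSpace ht0 ht1 hD (hg₂ ▸ hx)
  refine ⟨hzero, ?_⟩
  let C := lieCenterSub K L ⊓ lieDerivedSub K L
  let N := g₂.comap (lieDerivedSub K L).subtype
  let res : lieDerivSpace K L t →ₗ[K] (lieDerivedSub K L →ₗ[K] L) :=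
    LinearMap.lcomp K L (lieDerivedSub K L).subtype ∘ₗ (lieDerivSpace K L t).subtype
  have hker : Module.finrank K (LinearMap.ker res) ≤ Module.finrank K (lieOmega K L) := by
    rw [← Submodule.finrank_map_subtype_eq]
    refine Submodule.finrank_mono ?_
    rintro _ ⟨D, hD, rfl⟩
    exact mem_lieOmega_of_mem_lieDerivSpace D.2 fun x hx =>
      LinearMap.congr_fun (LinearMap.mem_ker.mp hD) ⟨x, hx⟩
  have hrange : LinearMap.range res ≤ LinearMap.range (homQuotientToHom N C) := by
    rintro _ ⟨D, rfl⟩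
    refine ⟨N.liftQ (D.1.restrict (q := C) fun x hx =>
      apply_mem_center_inf_derived ht0 ht1 D.2 hx) fun x hx => ?_, rfl⟩
    exact Subtype.ext (hzero D D.2 x hx)
  rw [← LinearMap.finrank_range_add_finrank_ker res, add_comm]
  exact add_le_add hker ((Submodule.finrank_mono hrange).trans (LinearMap.finrank_range_le _))
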